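/- Let A₁, …, A_N be n×n positive definite complex matrices, let ω = (w₁, …, w_N) be a positive probability vector, let 0 ≤ t < z ≤ 1, and suppose the positive definite matrix X satisfies the Rényi power mean equation X = Σⱼ wⱼ (Aⱼ^{(1-t)/(2z)} X^{t/z} Aⱼ^{(1-t)/(2z)})^z. If X ≤ I in the Loewner order, then X^{1/(1-t)} ⪯ Q_{1-t}(ω; A₁, …, A_N) = (Σⱼ wⱼ Aⱼ^{1-t})^{1/(1-t)} in the near-order. -/

import Mathlib

open Matrix
open scoped ComplexOrder

/-- Real power of a matrix via functional calculus on the spectrum (junk value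
if the matrix is not Hermitian). -/
noncomputable def mrpow {n : ℕ} (A : Matrix (Fin n) (Fin n) ℂ) (r : ℝ) :
    Matrix (Fin n) (Fin n) ℂ :=
  if hA : A.IsHermitian then
    (hA.eigenvectorUnitary : Matrix (Fin n) (Fin n) ℂ) *
      diagonal (fun i => ((hA.eigenvalues i ^ r : ℝ) : ℂ)) *
      (star (hA.eigenvectorUnitary : Matrix (Fin n) (Fin n) ℂ))
  else A

/-- The metric geometric mean `A # B = A^{1/2} (A^{-1/2} B A^{-1/2})^{1/2} A^{1/2}`. -/
noncomputable def sharp {n : ℕ} (A B : Matrix (Fin n) (Fin n) ℂ) :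
    Matrix (Fin n) (Fin n) ℂ :=
  mrpow A (1/2) * mrpow (mrpow A (-(1/2)) * B * mrpow A (-(1/2))) (1/2) * mrpow A (1/2)

/-- The Loewner order `A ≤ B`, i.e. `B - A` is positive semidefinite. -/
def loewnerLE {n : ℕ} (A B : Matrix (Fin n) (Fin n) ℂ) : Prop := (B - A).PosSemidef

/-- The near-order `A ⪯ B`, i.e. `A⁻¹ # B ≥ I` in the Loewner order. -/
def nearLE {n : ℕ} (A B : Matrix (Fin n) (Fin n) ℂ) : Prop := loewnerLE 1 (sharp A⁻¹ B)

/-- The quasi-arithmetic mean `Q_p(ω; A₁, …, A_N) = (Σⱼ wⱼ Aⱼ^p)^{1/p}`. -/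
noncomputable def quasiArith {n N : ℕ} (w : Fin N → ℝ) (p : ℝ)
    (A : Fin N → Matrix (Fin n) (Fin n) ℂ) : Matrix (Fin n) (Fin n) ℂ :=
  mrpow (∑ j, w j • mrpow (A j) p) (1/p)

section gen
variable {R : Type*} [CStarAlgebra R] [PartialOrder R] [StarOrderedRing R]

/-- geometric mean -/
noncomputable def gmean (a b : R) : R :=
  a ^ (1/2 : ℝ) * (a ^ (-(1/2) : ℝ) * b * a ^ (-(1/2) : ℝ)) ^ (1/2 : ℝ) * a ^ (1/2 : ℝ)

lemma half_mul_half (x : R) (hx : 0 ≤ x) : x ^ (1/2 : ℝ) * x ^ (1/2 : ℝ) = x := by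
  rw [← CFC.sqrt_eq_rpow, CFC.sqrt_mul_sqrt_self x hx]

lemma mul_self_half (x : R) (hx : 0 ≤ x) : (x * x) ^ (1/2 : ℝ) = x := by
  rw [← CFC.sqrt_eq_rpow, CFC.sqrt_mul_self x hx]

lemma le_of_mul_self_le {x y : R} (hx : 0 ≤ x) (hy : 0 ≤ y) (h : x * x ≤ y * y) : x ≤ y := by
  have := CFC.rpow_le_rpow (p := (1/2 : ℝ)) (by constructor <;> norm_num) h
  rwa [mul_self_half x hx, mul_self_half y hy] at this

lemma conj_sa {x y : R} (h : x ≤ y) {c : R} (hc : IsSelfAdjoint c) : c * x * c ≤ c * y * c :=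
  hc.conjugate_le_conjugate h

lemma riccati_mono {d K G : R} (hd : IsStrictlyPositive d) (hK : 0 ≤ K) (hG : 0 ≤ G)
    (h : G * d * G ≤ K * d * K) : G ≤ K := by
  set e := d ^ (1/2 : ℝ) with he
  set f := d ^ (-(1/2) : ℝ) with hf
  have hee : e * e = d := half_mul_half d hd.nonneg
  have hef : e * f = 1 := CFC.rpow_mul_rpow_neg (1/2) hd
  have hfe : f * e = 1 := CFC.rpow_neg_mul_rpow (1/2) hd
  have e0 : 0 ≤ e := CFC.rpow_nonneg
  have f0 : 0 ≤ f := CFC.rpow_nonneg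
  have h1 : e * G * e ≤ e * K * e := by
    refine le_of_mul_self_le (conjugate_nonneg_of_nonneg hG e0)
      (conjugate_nonneg_of_nonneg hK e0) ?_
    have := conj_sa h (IsSelfAdjoint.of_nonneg e0)
    rw [← hee] at this
    simpa only [mul_assoc] using this
  have h2 := conj_sa h1 (IsSelfAdjoint.of_nonneg f0)
  have key : ∀ x, f * (e * x * e) * f = x := fun x => by
    calc f * (e * x * e) * f = (f * e) * x * (e * f) := by noncomm_ring
      _ = x := by rw [hef, hfe]; simp
  rwa [key, key] at h2

lemma gmean_double {a b : R} (ha : IsStrictlyPositive a) (hb : IsStrictlyPositive b)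
    (h : 1 ≤ gmean a b) : 1 ≤ gmean (a * a) (b * b) := by
  unfold gmean at h
  set k := a ^ (1/2 : ℝ) with hk
  set f := a ^ (-(1/2) : ℝ) with hf
  have hkk : k * k = a := half_mul_half a ha.nonneg
  have hkf : k * f = 1 := CFC.rpow_mul_rpow_neg (1/2) ha
  have hfk : f * k = 1 := CFC.rpow_neg_mul_rpow (1/2) ha
  have k0 : 0 ≤ k := CFC.rpow_nonneg
  have f0 : 0 ≤ f := CFC.rpow_nonneg
  have fsp : IsStrictlyPositive f := IsStrictlyPositive.rpow a _ ha
  have Cn : 0 ≤ f * b * f := conjugate_nonneg_of_nonneg hb.nonneg f0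
  have Csp : IsStrictlyPositive (f * b * f) :=
    ((fsp.isUnit.mul hb.isUnit).mul fsp.isUnit).isStrictlyPositive Cn
  set c := (f * b * f) ^ (1/2 : ℝ) with hc
  have hcc : c * c = f * b * f := half_mul_half _ Cn
  have csp : IsStrictlyPositive c := IsStrictlyPositive.rpow _ _ Csp
  have c0 := csp.nonneg
  have hbk : b = k * (c * c) * k := by
    rw [hcc]
    calc b = (k * f) * b * (f * k) := by rw [hkf, hfk]; simp
      _ = _ := by noncomm_ring
  -- f f ≤ c
  have hffc : f * f ≤ c := by
    have := conj_sa h (IsSelfAdjoint.of_nonneg f0)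
    calc f * f = f * 1 * f := by simp
      _ ≤ _ := this
      _ = (f * k) * c * (k * f) := by noncomm_ring
      _ = c := by rw [hfk, hkf]; simp
  -- inverse
  set d := c ^ (-1 : ℝ) with hd
  have hcd : c * d = 1 := by
    simpa [CFC.rpow_one c c0] using CFC.rpow_mul_rpow_neg (a := c) 1 csp
  have ffsp : IsStrictlyPositive (f * f) := by
    refine (fsp.isUnit.mul fsp.isUnit).isStrictlyPositive ?_
    simpa using conjugate_nonneg_of_nonneg (zero_le_one' R) f0
  have hffinv : (f * f) ^ (-1 : ℝ) = k * k := by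
    have h1 : (f * f) * (f * f) ^ (-1 : ℝ) = 1 := by
      simpa [CFC.rpow_one (f * f) ffsp.nonneg] using
        CFC.rpow_mul_rpow_neg (a := f * f) 1 ffsp
    calc (f * f) ^ (-1 : ℝ) = k * (k * f) * f * (f * f) ^ (-1 : ℝ) := by
          rw [hkf, mul_one, hkf, one_mul]
      _ = k * k * ((f * f) * (f * f) ^ (-1 : ℝ)) := by noncomm_ring
      _ = k * k := by rw [h1, mul_one]
  have hdk : d ≤ k * k := by
    rw [← hffinv]
    exact CStarAlgebra.rpow_neg_one_le_rpow_neg_one hffc ffsp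
  -- K
  have a2 : IsStrictlyPositive (a * a) := by
    refine (ha.isUnit.mul ha.isUnit).isStrictlyPositive ?_
    simpa using conjugate_nonneg_of_nonneg (zero_le_one' R) ha.nonneg
  have b2 : 0 ≤ b * b := by
    simpa using conjugate_nonneg_of_nonneg (zero_le_one' R) hb.nonneg
  have hA : (a * a) ^ (1/2 : ℝ) = a := mul_self_half a ha.nonneg
  have hAi : (a * a) ^ (-(1/2) : ℝ) = f * f := by
    have h1 : a * (a * a) ^ (-(1/2) : ℝ) = 1 := by
      have := CFC.rpow_mul_rpow_neg (1/2) a2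
      rwa [hA] at this
    calc (a * a) ^ (-(1/2) : ℝ) = f * (f * k) * k * (a * a) ^ (-(1/2) : ℝ) := by
          rw [hfk, mul_one, hfk, one_mul]
      _ = f * f * ((k * k) * (a * a) ^ (-(1/2) : ℝ)) := by noncomm_ring
      _ = f * f := by rw [hkk, h1, mul_one]
  have Qn : 0 ≤ (f * f) * (b * b) * (f * f) := conjugate_nonneg_of_nonneg b2 ffsp.nonneg
  unfold gmean
  rw [hA, hAi]
  set q := ((f * f) * (b * b) * (f * f)) ^ (1/2 : ℝ) with hq
  have hqq : q * q = (f * f) * (b * b) * (f * f) := half_mul_half _ Qn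
  have q0 : 0 ≤ q := CFC.rpow_nonneg
  have K0 : 0 ≤ a * q * a := conjugate_nonneg_of_nonneg q0 ha.nonneg
  have G0 : 0 ≤ k * c * k := conjugate_nonneg_of_nonneg c0 k0
  have haf : a * (f * f) = 1 := by
    rw [← hkk]
    calc k * k * (f * f) = k * (k * f) * f := by noncomm_ring
      _ = 1 := by rw [hkf, mul_one, hkf]
  have hfa : (f * f) * a = 1 := by
    rw [← hkk]
    calc f * f * (k * k) = f * (f * k) * k := by noncomm_ring
      _ = 1 := by rw [hfk, mul_one, hfk]
  refine h.trans (riccati_mono (d := f * c * f) ?_ K0 G0 ?_)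
  · exact ((fsp.isUnit.mul csp.isUnit).mul fsp.isUnit).isStrictlyPositive
      (conjugate_nonneg_of_nonneg c0 f0)
  · calc k * c * k * (f * c * f) * (k * c * k)
        = k * c * (k * f) * c * (f * k) * c * k := by noncomm_ring
      _ = k * ((c * d) * (c * c) * c) * k := by rw [hkf, hfk, hcd]; noncomm_ring
      _ = k * ((c * c) * d * (c * c)) * k := by
          have hdc : d * c = 1 := by
            simpa [CFC.rpow_one c c0] using CFC.rpow_neg_mul_rpow (a := c) 1 csp
          rw [hcd]
          calc k * (1 * (c * c) * c) * k = k * (c * c * 1 * c) * k := by noncomm_ring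
            _ = _ := by rw [← hdc]; noncomm_ring
      _ ≤ k * ((c * c) * (k * k) * (c * c)) * k := by
          refine conj_sa (conj_sa hdk ?_) (IsSelfAdjoint.of_nonneg k0)
          rw [hcc]; exact IsSelfAdjoint.of_nonneg Cn
      _ = b * b := by rw [hbk]; noncomm_ring
      _ = (a * (f * f)) * (b * b) * ((f * f) * a) := by rw [haf, hfa]; simp
      _ = a * (q * q) * a := by rw [hqq]; noncomm_ring
      _ = a * q * (a * (f * f)) * ((f * f) * a) * q * a := by rw [haf, hfa]; noncomm_ring
      _ = a * q * a * (f * (f * f) * f) * (a * q * a) := by noncomm_ring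
      _ ≤ a * q * a * (f * c * f) * (a * q * a) :=
          conj_sa (conj_sa hffc (IsSelfAdjoint.of_nonneg f0)) (IsSelfAdjoint.of_nonneg K0)

lemma gmean_base {x s : R} (hx : IsStrictlyPositive x) (h : x ≤ s) :
    1 ≤ gmean (x ^ (-1 : ℝ)) s := by
  have e1 : (x ^ (-1 : ℝ)) ^ (1/2 : ℝ) = x ^ (-(1/2) : ℝ) := by
    rw [CFC.rpow_rpow (ha := hx) (hx := by norm_num)]; norm_num
  have e2 : (x ^ (-1 : ℝ)) ^ (-(1/2) : ℝ) = x ^ (1/2 : ℝ) := by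
    rw [CFC.rpow_rpow (ha := hx) (hx := by norm_num)]; norm_num
  unfold gmean
  rw [e1, e2]
  set k := x ^ (1/2 : ℝ) with hk
  set f := x ^ (-(1/2) : ℝ) with hf
  have hkk : k * k = x := half_mul_half x hx.nonneg
  have hkf : k * f = 1 := CFC.rpow_mul_rpow_neg (1/2) hx
  have hfk : f * k = 1 := CFC.rpow_neg_mul_rpow (1/2) hx
  have k0 : 0 ≤ k := CFC.rpow_nonneg
  have f0 : 0 ≤ f := CFC.rpow_nonneg
  have h1 := conj_sa h (IsSelfAdjoint.of_nonneg k0)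
  have h2 := CFC.rpow_le_rpow (p := (1/2 : ℝ)) (by constructor <;> norm_num) h1
  have h3 : k * x * k = x * x := by rw [← hkk]; noncomm_ring
  rw [h3, mul_self_half x hx.nonneg] at h2
  refine le_trans (le_of_eq ?_) (conj_sa h2 (IsSelfAdjoint.of_nonneg f0))
  rw [← hkk]
  calc (1 : R) = (f * k) * (k * f) := by rw [hfk, hkf, one_mul]
    _ = _ := by noncomm_ring

lemma gmean_pow {x s : R} (hx : IsStrictlyPositive x) (hs : IsStrictlyPositive s) (h : x ≤ s)
    (m : ℕ) : ∀ r : ℝ, 0 < r → r ≤ 2 ^ m → 1 ≤ gmean (x ^ (-r)) (s ^ r) := by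
  induction m with
  | zero =>
    intro r hr hr1
    have := gmean_base (IsStrictlyPositive.rpow x r hx)
      (CFC.rpow_le_rpow (p := r) ⟨hr.le, by simpa using hr1⟩ h)
    rwa [CFC.rpow_rpow (ha := hx) (hx := hr.ne'), mul_neg_one] at this
  | succ m ih =>
    intro r hr hr1
    have := gmean_double (IsStrictlyPositive.rpow x _ hx) (IsStrictlyPositive.rpow s _ hs)
      (ih (r/2) (by positivity) (by rw [pow_succ] at hr1; linarith))
    rw [← CFC.rpow_add hx.isUnit, ← CFC.rpow_add hs.isUnit] at this
    convert this using 3 <;> ring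

end gen

section mat
open scoped MatrixOrder Matrix.Norms.L2Operator

lemma mrpow_eq {n : ℕ} {A : Matrix (Fin n) (Fin n) ℂ} (hA : 0 ≤ A) (r : ℝ) :
    mrpow A r = A ^ r := by
  have hH : A.IsHermitian := hA.posSemidef.isHermitian
  rw [CFC.rpow_eq_cfc_real hA, hH.cfc_eq, mrpow, dif_pos hH]
  rfl

lemma sharp_eq {n : ℕ} {A B : Matrix (Fin n) (Fin n) ℂ} (hA : 0 ≤ A) (hB : 0 ≤ B) :
    sharp A B = gmean A B := by
  rw [sharp, gmean, mrpow_eq hA, mrpow_eq hA, mrpow_eq]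
  exact conjugate_nonneg_of_nonneg hB CFC.rpow_nonneg

lemma inv_rpow_eq {n : ℕ} {X : Matrix (Fin n) (Fin n) ℂ} (hX : IsStrictlyPositive X) (r : ℝ) :
    (X ^ r)⁻¹ = X ^ (-r) :=
  Matrix.inv_eq_right_inv (CFC.rpow_mul_rpow_neg r hX)

lemma renyi_aux {n N : ℕ}
    (A : Fin N → Matrix (Fin n) (Fin n) ℂ) (hA : ∀ j, (A j).PosDef)
    (w : Fin N → ℝ) (hw : ∀ j, 0 < w j)
    (t z : ℝ) (ht0 : 0 ≤ t) (htz : t < z) (hz1 : z ≤ 1)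
    (X : Matrix (Fin n) (Fin n) ℂ) (hX : X.PosDef)
    (hfix : X = ∑ j, w j •
      mrpow (mrpow (A j) ((1 - t) / (2 * z)) * mrpow X (t / z) *
        mrpow (A j) ((1 - t) / (2 * z))) z)
    (hX1 : loewnerLE X 1) :
    nearLE (mrpow X (1 / (1 - t))) (quasiArith w (1 - t) A) := by
  have hz : 0 < z := ht0.trans_lt htz
  have hp : 0 < 1 - t := by linarith
  have hXs : IsStrictlyPositive X := Matrix.isStrictlyPositive_iff_posDef.mpr hX
  have hAs : ∀ j, IsStrictlyPositive (A j) := fun j =>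
    Matrix.isStrictlyPositive_iff_posDef.mpr (hA j)
  have hX1' : X ≤ 1 := hX1
  have hXt : X ^ (t / z) ≤ 1 := by
    have := CFC.rpow_le_rpow (p := t / z) ⟨by positivity, (div_le_one hz).2 htz.le⟩ hX1'
    rwa [CFC.one_rpow] at this
  have hXS : X ≤ ∑ j, w j • mrpow (A j) (1 - t) := by
    conv_lhs => rw [hfix]
    refine Finset.sum_le_sum fun j _ => smul_le_smul_of_nonneg_left ?_ (hw j).le
    have h0 : 0 ≤ (A j) ^ ((1 - t) / (2 * z)) := CFC.rpow_nonneg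
    rw [mrpow_eq (hAs j).nonneg, mrpow_eq (hAs j).nonneg, mrpow_eq hXs.nonneg,
      mrpow_eq (conjugate_nonneg_of_nonneg CFC.rpow_nonneg h0)]
    have h1 := conj_sa hXt (IsSelfAdjoint.of_nonneg h0)
    rw [mul_one, ← CFC.rpow_add (hAs j).isUnit] at h1
    have h2 := CFC.rpow_le_rpow (p := z) ⟨hz.le, hz1⟩ h1
    have hne : (1 - t) / (2 * z) + (1 - t) / (2 * z) ≠ 0 := by positivity
    rw [CFC.rpow_rpow (ha := hAs j) (hx := hne)] at h2
    convert h2 using 2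
    field_simp
    norm_num
  have hSs := hXs.of_le hXS
  obtain ⟨m, hm⟩ := pow_unbounded_of_one_lt (1 / (1 - t)) (one_lt_two (α := ℝ))
  have := gmean_pow hXs hSs hXS m (1 / (1 - t)) (by positivity) hm.le
  rw [← inv_rpow_eq hXs] at this
  unfold nearLE quasiArith
  rw [mrpow_eq hXs.nonneg, mrpow_eq hSs.nonneg, sharp_eq]
  · exact this
  · rw [inv_rpow_eq hXs]; exact CFC.rpow_nonneg
  · exact CFC.rpow_nonneg

end mat

theorem renyi_nearLE_quasiArith_of_le_one {n N : ℕ}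
    (A : Fin N → Matrix (Fin n) (Fin n) ℂ) (hA : ∀ j, (A j).PosDef)
    (w : Fin N → ℝ) (hw : ∀ j, 0 < w j) (hw1 : ∑ j, w j = 1)
    (t z : ℝ) (ht0 : 0 ≤ t) (htz : t < z) (hz1 : z ≤ 1)
    (X : Matrix (Fin n) (Fin n) ℂ) (hX : X.PosDef)
    (hfix : X = ∑ j, w j •
      mrpow (mrpow (A j) ((1 - t) / (2 * z)) * mrpow X (t / z) *
        mrpow (A j) ((1 - t) / (2 * z))) z)
    (hX1 : loewnerLE X 1) :
    nearLE (mrpow X (1 / (1 - t))) (quasiArith w (1 - t) A) := by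
  exact renyi_aux A hA w hw t z ht0 htz hz1 X hX hfix hX1
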